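/- Let a, b, w be bilinear real functions of two variables, i.e., a(u,v) = a₀ + a₁·u + a₂·v + a₃·u·v (and similarly for b and w). Define x = 2·a·b·w, y = (a² − b²)·w, z = (a² + b²)·w. Then: (1) the Pythagorean identity x² + y² = z² holds identically as polynomials in (u, v); and (2) each of x, y, z is a polynomial of degree at most 3 in u and degree at most 3 in v. Hence (x, y, z) is a bicubic parameterization of (part of) the rotational cone x² + y² = z². -/

import Mathlib

/-- Real functions of two variables that are polynomials of degree at most `n` in each variable. -/
def bidegreeLE (n : ℕ) : Submodule ℝ (ℝ → ℝ → ℝ) :=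
  Submodule.span ℝ (Set.range fun (p : Fin (n + 1) × Fin (n + 1)) (u v : ℝ) =>
    u ^ (p.1 : ℕ) * v ^ (p.2 : ℕ))

theorem mem_bidegreeLE_iff {n : ℕ} {f : ℝ → ℝ → ℝ} :
    f ∈ bidegreeLE n ↔ ∃ c : Fin (n + 1) → Fin (n + 1) → ℝ, ∀ u v : ℝ,
      f u v = ∑ i, ∑ j, c i j * u ^ (i : ℕ) * v ^ (j : ℕ) := by
  rw [bidegreeLE, Submodule.mem_span_range_iff_exists_fun]
  constructor
  · rintro ⟨c, rfl⟩
    exact ⟨fun i j => c (i, j), fun u v => by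
      simp [Finset.sum_apply, Fintype.sum_prod_type, mul_assoc]⟩
  · rintro ⟨c, hc⟩
    refine ⟨fun p => c p.1 p.2, ?_⟩
    ext u v
    simp [hc, Finset.sum_apply, Fintype.sum_prod_type, mul_assoc]

theorem mul_mem_bidegreeLE {m n : ℕ} {f g : ℝ → ℝ → ℝ}
    (hf : f ∈ bidegreeLE m) (hg : g ∈ bidegreeLE n) : f * g ∈ bidegreeLE (m + n) := by
  have h := Submodule.mul_mem_mul hf hg
  rw [bidegreeLE, bidegreeLE, Submodule.span_mul_span] at h
  refine Submodule.span_mono ?_ h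
  rintro _ ⟨_, ⟨⟨i, j⟩, rfl⟩, _, ⟨⟨k, l⟩, rfl⟩, rfl⟩
  refine ⟨(⟨i + k, by lia⟩, ⟨j + l, by lia⟩), ?_⟩
  ext u v
  simp only [Pi.mul_apply]
  ring

theorem bilinear_mem_bidegreeLE_one (c₀ c₁ c₂ c₃ : ℝ) :
    (fun u v => c₀ + c₁ * u + c₂ * v + c₃ * u * v) ∈ bidegreeLE 1 := by
  refine mem_bidegreeLE_iff.2 ⟨![![c₀, c₂], ![c₁, c₃]], fun u v => ?_⟩
  simp [Fin.sum_univ_two]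
  ring

/-- Let `a, b, w` be bilinear real functions of two variables, and set `x = 2·a·b·w`,
`y = (a² − b²)·w`, `z = (a² + b²)·w`. Then (1) `x² + y² = z²` holds identically, and
(2) each of `x, y, z` is a polynomial of degree at most 3 in `u` and at most 3 in `v`.
Hence `(x, y, z)` is a bicubic parameterization of (part of) the rotational cone
`x² + y² = z²`. -/
theorem bilinear_pythagorean_triple_bicubic_cone
    (a₀ a₁ a₂ a₃ b₀ b₁ b₂ b₃ w₀ w₁ w₂ w₃ : ℝ)
    (a b w x y z : ℝ → ℝ → ℝ)
    (ha : a = fun u v => a₀ + a₁ * u + a₂ * v + a₃ * u * v)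
    (hb : b = fun u v => b₀ + b₁ * u + b₂ * v + b₃ * u * v)
    (hw : w = fun u v => w₀ + w₁ * u + w₂ * v + w₃ * u * v)
    (hx : x = fun u v => 2 * a u v * b u v * w u v)
    (hy : y = fun u v => (a u v ^ 2 - b u v ^ 2) * w u v)
    (hz : z = fun u v => (a u v ^ 2 + b u v ^ 2) * w u v) :
    (∀ u v : ℝ, x u v ^ 2 + y u v ^ 2 = z u v ^ 2) ∧
    (∃ cx cy cz : Fin 4 → Fin 4 → ℝ, ∀ u v : ℝ,
      x u v = ∑ i : Fin 4, ∑ j : Fin 4, cx i j * u ^ (i : ℕ) * v ^ (j : ℕ) ∧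
      y u v = ∑ i : Fin 4, ∑ j : Fin 4, cy i j * u ^ (i : ℕ) * v ^ (j : ℕ) ∧
      z u v = ∑ i : Fin 4, ∑ j : Fin 4, cz i j * u ^ (i : ℕ) * v ^ (j : ℕ)) := by
  have ha' : a ∈ bidegreeLE 1 := ha ▸ bilinear_mem_bidegreeLE_one a₀ a₁ a₂ a₃
  have hb' : b ∈ bidegreeLE 1 := hb ▸ bilinear_mem_bidegreeLE_one b₀ b₁ b₂ b₃
  have hw' : w ∈ bidegreeLE 1 := hw ▸ bilinear_mem_bidegreeLE_one w₀ w₁ w₂ w₃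
  have haa := mul_mem_bidegreeLE ha' ha'
  have hbb := mul_mem_bidegreeLE hb' hb'
  have hab := Submodule.smul_mem _ (2 : ℝ) (mul_mem_bidegreeLE ha' hb')
  obtain ⟨cx, hcx⟩ := mem_bidegreeLE_iff.1 (mul_mem_bidegreeLE hab hw')
  obtain ⟨cy, hcy⟩ := mem_bidegreeLE_iff.1
    (mul_mem_bidegreeLE (Submodule.sub_mem _ haa hbb) hw')
  obtain ⟨cz, hcz⟩ := mem_bidegreeLE_iff.1
    (mul_mem_bidegreeLE (Submodule.add_mem _ haa hbb) hw')
  refine ⟨fun u v => ?_, cx, cy, cz, fun u v => ⟨?_, ?_, ?_⟩⟩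
  · simp only [hx, hy, hz]
    ring
  · rw [← hcx, hx]
    simp [mul_assoc]
  · rw [← hcy, hy]
    simp [sq]
  · rw [← hcz, hz]
    simp [sq]
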